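/- Let d ≥ 3 and M, k ≥ 1 be integers, and let f be chosen uniformly at random from L_M(d,k). Then for every integer t ≥ 1, Pr(f(v_0) = M + t) ≤ ((3/4)^d)^(d^⌊(t-1)/M⌋) · Pr(f(v_0) = 0). -/

import Mathlib

/-- The vertices of the rooted `d`-ary tree of depth `k`: sequences over `Fin d`
of length at most `k`.  The root is the empty sequence, the children of a vertex
`l` with `l.length < k` are the vertices `l ++ [j]` for `j : Fin d`, and the
leaves are the vertices of length exactly `k`. -/
abbrev Vtx (d k : ℕ) : Type := {l : List (Fin d) // l.length ≤ k}

/-- The root `v₀` of the tree. -/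
def rootV (d k : ℕ) : Vtx d k := ⟨[], by simp⟩

/-- `L_M(d,k)`: the set of integer-valued `M`-Lipschitz functions on the
`d`-ary tree of depth `k` that vanish on all leaves. -/
def LM (d k M : ℕ) : Set (Vtx d k → ℤ) :=
  {f | (∀ v : Vtx d k, v.1.length = k → f v = 0) ∧
       (∀ (l : List (Fin d)) (hl : l.length + 1 ≤ k) (j : Fin d),
         |f ⟨l ++ [j], by simpa using hl⟩ - f ⟨l, Nat.le_of_succ_le hl⟩| ≤ (M : ℤ))}

/-- `G(t,k)`: the number of functions in `L_M(d,k)` whose value at the root is `t`. -/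
noncomputable def G (d k M : ℕ) (t : ℤ) : ℕ :=
  Nat.card {f : Vtx d k → ℤ // f ∈ LM d k M ∧ f (rootV d k) = t}

/-- The probability that a uniformly random element of `L_M(d,k)` takes the
value `t` at the root. -/
noncomputable def PrRoot (d k M : ℕ) (t : ℤ) : ℝ :=
  (G d k M t : ℝ) / (Nat.card (LM d k M) : ℝ)

open Finset

/-- The sum of `g` over the window of radius `M` centred at `t`. -/
def windowSum (M : ℕ) (g : ℤ → ℝ) (t : ℤ) : ℝ :=
  ∑ i ∈ range (2 * M + 1), g (t - M + i)

lemma windowSum_nonneg {M : ℕ} {g : ℤ → ℝ} (hg : ∀ a, 0 ≤ g a) (t : ℤ) :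
    0 ≤ windowSum M g t :=
  sum_nonneg fun _ _ => hg _

lemma windowSum_neg {M : ℕ} {g : ℤ → ℝ} (hg : ∀ a, g (-a) = g a) (t : ℤ) :
    windowSum M g (-t) = windowSum M g t := by
  unfold windowSum
  rw [← sum_range_reflect]
  refine sum_congr rfl fun i hi => ?_
  rw [mem_range] at hi
  rw [← hg]
  congr 1
  omega

lemma windowSum_anti {M : ℕ} {g : ℤ → ℝ} (hg : ∀ a b, |a| ≤ |b| → g b ≤ g a) (a b : ℤ)
    (hab : |a| ≤ |b|) : windowSum M g b ≤ windowSum M g a := by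
  have hsymm : ∀ a, g (-a) = g a := fun a =>
    le_antisymm (hg _ _ (abs_neg a).ge) (hg _ _ (abs_neg a).le)
  have habs : ∀ t, windowSum M g t = windowSum M g (t.natAbs : ℤ) := fun t => by
    rcases Int.natAbs_eq t with h | h
    · rw [← h]
    · rw [← windowSum_neg hsymm, show -t = (t.natAbs : ℤ) by omega]
  have hanti : Antitone fun n : ℕ => windowSum M g (n : ℤ) := by
    refine antitone_nat_of_succ_le fun n => ?_
    simp only [windowSum]
    rw [sum_range_succ, sum_range_succ' (fun i : ℕ => g ((n : ℤ) - M + i))]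
    refine add_le_add (sum_le_sum fun i _ => le_of_eq ?_) (hg _ _ ?_)
    · congr 1
      push_cast
      ring
    · simp only [Int.abs_eq_natAbs]
      omega
  rw [habs a, habs b]
  simp only [Int.abs_eq_natAbs] at hab
  exact hanti (by omega)

lemma windowSum_shift_le {M : ℕ} {g : ℤ → ℝ} {q : ℝ} (hg0 : ∀ a, 0 ≤ g a)
    (hg : ∀ a b, |a| ≤ |b| → g b ≤ g a) (hq : q ≤ 1 / 2)
    (hgap : ∀ s : ℕ, g (s + M + 1) ≤ q * g s) (s : ℕ) :
    windowSum M g (s + M + 1) ≤ 3 / 4 * windowSum M g s := by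
  set C := ∑ i ∈ range M, g ((s : ℤ) + 1 + i) with hC
  have hC0 : 0 ≤ C := sum_nonneg fun _ _ => hg0 _
  have hfar : ∑ i ∈ range (M + 1), g ((s : ℤ) + M + 1 + i) ≤ q * (C + g s) := by
    have hsum : C + g s = ∑ i ∈ range (M + 1), g ((s : ℤ) + i) := by
      rw [sum_range_succ', hC]
      congr 1
      refine sum_congr rfl fun i _ => ?_
      congr 1
      push_cast
      ring
    rw [hsum, mul_sum]
    refine sum_le_sum fun i _ => ?_
    have h := hgap (s + i)
    push_cast at h
    rwa [show (s : ℤ) + M + 1 + i = s + i + M + 1 by ring]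
  have hleft : windowSum M g (s + M + 1) =
      C + ∑ i ∈ range (M + 1), g ((s : ℤ) + M + 1 + i) := by
    rw [windowSum, show 2 * M + 1 = M + (M + 1) by ring, sum_range_add, hC]
    congr 1 <;> refine sum_congr rfl fun i _ => ?_ <;> congr 1 <;> push_cast <;> ring
  have hright : C + (g s + C) ≤ windowSum M g s := by
    rw [windowSum, show 2 * M + 1 = M + (M + 1) by ring, sum_range_add, sum_range_succ']
    rw [add_comm (g s) C]
    refine add_le_add ?_ (add_le_add (le_of_eq ?_) (le_of_eq ?_))
    · rw [hC, ← sum_range_reflect (fun i : ℕ => g ((s : ℤ) - M + i))]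
      refine sum_le_sum fun i hi => hg _ _ ?_
      rw [mem_range] at hi
      simp only [Int.abs_eq_natAbs]
      omega
    · refine sum_congr rfl fun i _ => ?_
      congr 1
      push_cast
      ring
    · congr 1
      push_cast
      ring
  rw [hleft]
  nlinarith [hg0 s]

lemma windowSum_shift_mul_le {M : ℕ} {g : ℤ → ℝ} {q : ℝ} (hq : 0 ≤ q)
    (hg : ∀ a b, |a| ≤ |b| → g b ≤ g a) (n : ℕ)
    (hgap : ∀ s : ℕ, g (s + n) ≤ q * g s) (s : ℕ) :
    windowSum M g (s + (n + M : ℕ)) ≤ q * windowSum M g s := by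
  calc windowSum M g (s + (n + M : ℕ)) ≤ q * windowSum M g (s + M) := by
        unfold windowSum
        rw [mul_sum]
        refine sum_le_sum fun i _ => ?_
        have h := hgap (s + i)
        push_cast at h ⊢
        rw [add_sub_cancel_right]
        rwa [show (s : ℤ) + (n + M) - M + i = s + i + n by ring]
    _ ≤ q * windowSum M g s := by
        refine mul_le_mul_of_nonneg_left (windowSum_anti hg _ _ ?_) hq
        simp only [Int.abs_eq_natAbs]
        omega

/-- A function on the tree of depth `k + 1` with prescribed root value amounts to a family of
functions on the `d` subtrees below the root. -/
def subtreeEquiv (d k M : ℕ) (t : ℤ) :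
    {f : Vtx d (k + 1) → ℤ // f ∈ LM d (k + 1) M ∧ f (rootV d (k + 1)) = t} ≃
      (Fin d → {f : Vtx d k → ℤ // f ∈ LM d k M ∧ |f (rootV d k) - t| ≤ M}) where
  toFun f j := ⟨fun v => f.1 ⟨j :: v.1, Nat.succ_le_succ v.2⟩,
    ⟨fun v hv => f.2.1.1 _ (by simp [hv]),
      fun l hl i => f.2.1.2 (j :: l) (by simpa using hl) i⟩, by
      have h := f.2.1.2 [] (by simp) j
      have ht : f.1 ⟨[], by simp⟩ = t := f.2.2
      rw [ht] at h
      exact h⟩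
  invFun F := ⟨fun v => match v with
      | ⟨[], _⟩ => t
      | ⟨j :: l, h⟩ => (F j).1 ⟨l, Nat.le_of_succ_le_succ h⟩, by
    refine ⟨⟨?_, ?_⟩, rfl⟩
    · rintro ⟨_ | ⟨j, l⟩, h⟩ hv
      · simp at hv
      · exact (F j).2.1.1 _ (by simpa using hv)
    · rintro (_ | ⟨i, l⟩) hl j
      · exact (F j).2.2
      · exact (F i).2.1.2 l (by simpa using hl) j⟩
  left_inv f := by
    ext ⟨_ | ⟨j, l⟩, h⟩
    · exact f.2.2.symm
    · rfl
  right_inv F := rfl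

/-- Sorting functions by their value at the root. -/
def rootValueEquiv (d k M : ℕ) (t : ℤ) :
    {f : Vtx d k → ℤ // f ∈ LM d k M ∧ |f (rootV d k) - t| ≤ M} ≃
      (Σ i : Fin (2 * M + 1),
        {f : Vtx d k → ℤ // f ∈ LM d k M ∧ f (rootV d k) = t - M + (i : ℕ)}) where
  toFun f := ⟨⟨(f.1 (rootV d k) - t + M).toNat, by have := abs_le.1 f.2.2; omega⟩,
    f.1, f.2.1, by have := abs_le.1 f.2.2; simp only; omega⟩
  invFun p := ⟨p.2.1, p.2.2.1, by
    have h := p.2.2.2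
    have hi := p.1.2
    rw [h, abs_le]; constructor <;> omega⟩
  left_inv f := rfl
  right_inv := by
    rintro ⟨⟨i, hi⟩, f, hf, h⟩
    have : (f (rootV d k) - t + M).toNat = i := by simp only at h; omega
    subst this
    rfl

lemma finite_rootFiber (d k M : ℕ) (t : ℤ) :
    Finite {f : Vtx d k → ℤ // f ∈ LM d k M ∧ f (rootV d k) = t} := by
  induction k generalizing t with
  | zero =>
    refine @Finite.of_subsingleton _ ⟨fun f g => Subtype.ext (funext fun v => ?_)⟩
    have hv : v.1.length = 0 := Nat.le_zero.1 v.2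
    rw [f.2.1.1 v hv, g.2.1.1 v hv]
  | succ k ih =>
    have := fun s => ih s
    have := Finite.of_equiv _ (rootValueEquiv d k M t).symm
    exact Finite.of_equiv _ (subtreeEquiv d k M t).symm

lemma G_succ (d k M : ℕ) (t : ℤ) :
    (G d (k + 1) M t : ℝ) = windowSum M (fun s => (G d k M s : ℝ)) t ^ d := by
  have := fun s => finite_rootFiber d k M s
  rw [G, Nat.card_congr ((subtreeEquiv d k M t).trans
    (Equiv.piCongrRight fun _ => rootValueEquiv d k M t)), Nat.card_fun, Nat.card_sigma,
    Nat.card_eq_fintype_card, Fintype.card_fin, windowSum, ← Fin.sum_univ_eq_sum_range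
      (fun i : ℕ => (G d k M (t - M + i) : ℝ))]
  push_cast
  rfl

lemma G_zero_of_ne (d M : ℕ) {t : ℤ} (ht : t ≠ 0) : G d 0 M t = 0 := by
  have : IsEmpty {f : Vtx d 0 → ℤ // f ∈ LM d 0 M ∧ f (rootV d 0) = t} :=
    ⟨fun f => ht (f.2.2.symm.trans (f.2.1.1 _ rfl))⟩
  exact Nat.card_of_isEmpty

lemma G_anti (d k M : ℕ) (a b : ℤ) (hab : |a| ≤ |b|) :
    (G d k M b : ℝ) ≤ G d k M a := by
  induction k generalizing a b with
  | zero =>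
    rcases eq_or_ne b 0 with rfl | hb
    · rw [show a = 0 by simpa using hab]
    · rw [G_zero_of_ne d M hb]
      simp
  | succ k ih =>
    rw [G_succ, G_succ]
    exact pow_le_pow_left₀ (windowSum_nonneg (fun _ => Nat.cast_nonneg _) _)
      (windowSum_anti ih a b hab) d

lemma G_shift_le (d k M : ℕ) (hd : 3 ≤ d) (s : ℕ) :
    (G d k M (s + M + 1) : ℝ) ≤ (3 / 4) ^ d * G d k M s := by
  induction k generalizing s with
  | zero =>
    rw [G_zero_of_ne d M (by omega)]
    simp only [Nat.cast_zero]
    positivity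
  | succ k ih =>
    have hq : (3 / 4 : ℝ) ^ d ≤ 1 / 2 :=
      (pow_le_pow_of_le_one (by norm_num) (by norm_num) hd).trans (by norm_num)
    rw [G_succ, G_succ, ← mul_pow]
    exact pow_le_pow_left₀ (windowSum_nonneg (fun _ => Nat.cast_nonneg _) _)
      (windowSum_shift_le (fun _ => Nat.cast_nonneg _) (G_anti d k M) hq ih s) d

lemma G_shift_mul_le (d k M : ℕ) (hd : 3 ≤ d) (n s : ℕ) :
    (G d k M (s + (n * M + M + 1 : ℕ)) : ℝ) ≤ ((3 / 4) ^ d) ^ d ^ n * G d k M s := by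
  induction n generalizing k s with
  | zero =>
    have h := G_shift_le d k M hd s
    simpa [add_assoc] using h
  | succ n ih =>
    cases k with
    | zero =>
      rw [G_zero_of_ne d M (by omega)]
      simp only [Nat.cast_zero]
      positivity
    | succ k =>
      rw [G_succ, G_succ, pow_succ d n, pow_mul _ (d ^ n) d, ← mul_pow]
      refine pow_le_pow_left₀ (windowSum_nonneg (fun _ => Nat.cast_nonneg _) _) ?_ d
      have h := windowSum_shift_mul_le (M := M) (by positivity) (G_anti d k M) _ (ih k) s
      rwa [show (n + 1) * M + M + 1 = n * M + M + 1 + M by ring]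

/-- **Theorem.**  Let `d ≥ 3` and `M, k ≥ 1`.  If `f` is chosen uniformly at random
from `L_M(d,k)`, then for every integer `t ≥ 1`,
`Pr(f(v₀) = M + t) ≤ ((3/4)^d) ^ (d ^ ⌊(t-1)/M⌋) * Pr(f(v₀) = 0)`. -/
theorem lipschitz_tree_root_upper_tail_d_ge_three (d M k : ℕ) (hd : 3 ≤ d)
    (hM : 1 ≤ M) (hk : 1 ≤ k) (t : ℤ) (ht : 1 ≤ t) :
    PrRoot d k M ((M : ℤ) + t) ≤
      ((3 / 4 : ℝ) ^ d) ^ (d ^ ((t - 1) / (M : ℤ)).toNat) * PrRoot d k M 0 := by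
  unfold PrRoot
  rw [← mul_div_assoc]
  refine div_le_div_of_nonneg_right ?_ (Nat.cast_nonneg _)
  obtain ⟨n, hn⟩ := Int.eq_ofNat_of_zero_le (Int.ediv_nonneg (by omega : 0 ≤ t - 1) M.cast_nonneg)
  have hle : (n : ℤ) * M ≤ t - 1 := by
    rw [← hn]
    exact Int.ediv_mul_le _ (by omega)
  have hnM : 0 ≤ (n : ℤ) * M := by positivity
  rw [hn, Int.toNat_natCast]
  refine (G_anti d k M ((0 : ℕ) + (n * M + M + 1 : ℕ)) _ ?_).trans
    (by simpa using G_shift_mul_le d k M hd n 0)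
  push_cast
  rw [abs_of_nonneg (by omega), abs_of_nonneg (by omega)]
  omega
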